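/- Let A ≥ 100 and 0 < δ ≤ σ ≤ 1, and let 𝓡 be a family of pairwise 100-incomparable (δ,σ)-rectangles. Then 𝓡 contains a subset 𝓡̄ consisting of pairwise A-incomparable rectangles with |𝓡̄| ≥ c A^{−50} |𝓡|, where c > 0 is an absolute constant. -/

import Mathlib

open Metric Set

noncomputable section

/-- The plane `ℝ²`. -/
abbrev Plane := EuclideanSpace ℝ (Fin 2)

/-- The parameter space `ℝ² × ℝ` of circles: a pair `(x, r)` of a centre and a radius. -/
abbrev Param := (EuclideanSpace ℝ (Fin 2)) × ℝ

/-- The point of `ℝ²` with coordinates `a`, `b`. -/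
def mk2 (a b : ℝ) : Plane := (WithLp.equiv 2 (Fin 2 → ℝ)).symm ![a, b]

/-- The Euclidean distance on `ℝ² × ℝ`, viewed as `ℝ³`. -/
def pdist (p q : Param) : ℝ := Real.sqrt (dist p.1 q.1 ^ 2 + (p.2 - q.2) ^ 2)

/-- The tangency parameter `Δ(p,q) = ||x - x'| - |r - r'||`. -/
def tang (p q : Param) : ℝ := abs (dist p.1 q.1 - |p.2 - q.2|)

/-- The domain `𝐃 = {(x,r) : |x| ≤ 1/4, r ∈ [1/2, 1]}`. -/
def domD : Set Param := {p | ‖p.1‖ ≤ 1 / 4 ∧ p.2 ∈ Set.Icc (1 / 2 : ℝ) 1}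

/-- The circle `S(p)` with centre `p.1` and radius `p.2`. -/
def circ (p : Param) : Set Plane := Metric.sphere p.1 p.2

/-- The closed `δ`-annulus `S^δ(p)` around the circle `S(p)`. -/
def annulus (δ : ℝ) (p : Param) : Set Plane := {w | Metric.infDist w (circ p) ≤ δ}

/-- The `(δ,σ)`-rectangle `R^δ_σ(p,v) = S^δ(p) ∩ B(v,σ)`. -/
def rect (δ σ : ℝ) (p : Param) (v : Plane) : Set Plane :=
  annulus δ p ∩ Metric.closedBall v σ

/-- Admissible data `(p, v)` for a rectangle: `p ∈ 𝐃` and `v ∈ S(p)`. -/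
def IsRectData (r : Param × Plane) : Prop := r.1 ∈ domD ∧ r.2 ∈ circ r.1

/-- `C`-comparability of two rectangles (given by their data): there is a third
`(δ,σ)`-rectangle `R` with `R₁ ∪ R₂ ⊆ C·R`. -/
def Comp (δ σ C : ℝ) (r₁ r₂ : Param × Plane) : Prop :=
  ∃ r : Param × Plane, IsRectData r ∧
    rect δ σ r₁.1 r₁.2 ∪ rect δ σ r₂.1 r₂.2 ⊆ rect (C * δ) (C * σ) r.1 r.2

/-- The index of the dyadic `δ`-cube of `ℝ²` containing a point. -/
def idx2 (δ : ℝ) (v : Plane) : ℤ × ℤ := (⌊v 0 / δ⌋, ⌊v 1 / δ⌋)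

/-- The index of the dyadic `δ`-cube of `ℝ³ = ℝ² × ℝ` containing a point. -/
def idx3 (δ : ℝ) (p : Param) : (ℤ × ℤ) × ℤ := (idx2 δ p.1, ⌊p.2 / δ⌋)

/-- `|E|_δ`: the number of dyadic `δ`-cubes intersecting `E ⊆ ℝ²`. -/
def count2 (δ : ℝ) (E : Set Plane) : ℕ := Nat.card (idx2 δ '' E)

/-- `|P|_δ`: the number of dyadic `δ`-cubes intersecting `P ⊆ ℝ³`. -/
def count3 (δ : ℝ) (P : Set Param) : ℕ := Nat.card (idx3 δ '' P)

/-- `|Ω|_δ`: the number of dyadic `δ`-cubes of `ℝ⁵ = ℝ³ × ℝ²` intersecting `Ω`. -/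
def count5 (δ : ℝ) (Ω : Set (Param × Plane)) : ℕ :=
  Nat.card ((fun ω => (idx3 δ ω.1, idx2 δ ω.2)) '' Ω)

/-- A `(δ,s,C)`-set in the plane. -/
def IsDSet2 (δ s C : ℝ) (E : Set Plane) : Prop :=
  Bornology.IsBounded E ∧ ∀ (x : Plane) (r : ℝ), δ ≤ r →
    (count2 δ (E ∩ Metric.closedBall x r) : ℝ) ≤ C * r ^ s * (count2 δ E : ℝ)

/-- A `(δ,s,C)`-set in `ℝ³ = ℝ² × ℝ`. -/
def IsDSet3 (δ s C : ℝ) (P : Set Param) : Prop :=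
  Bornology.IsBounded P ∧ ∀ (x : Param) (r : ℝ), δ ≤ r →
    (count3 δ (P ∩ {q | pdist q x ≤ r}) : ℝ) ≤ C * r ^ s * (count3 δ P : ℝ)

/-- `x ∈ 2^{-ℕ}`. -/
def IsDyadic (x : ℝ) : Prop := ∃ n : ℕ, x = (2 : ℝ) ^ (-(n : ℤ))

/-- The smallest dyadic rational `2^{-n} ≥ σ` (for `σ ∈ (0,1]`). -/
def dyadicCeil (σ : ℝ) : ℝ := (2 : ℝ) ^ (-⌊Real.logb 2 σ⁻¹⌋)

/-- Indices of dyadic cubes in `ℝ³ = ℝ² × ℝ`. -/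
abbrev CubeIdx := (ℤ × ℤ) × ℤ

/-- The dyadic cube of side length `δ` with index `k`. -/
def cubeSet (δ : ℝ) (k : CubeIdx) : Set Param :=
  {p | (k.1.1 : ℝ) * δ ≤ p.1 0 ∧ p.1 0 < ((k.1.1 : ℝ) + 1) * δ ∧
       (k.1.2 : ℝ) * δ ≤ p.1 1 ∧ p.1 1 < ((k.1.2 : ℝ) + 1) * δ ∧
       (k.2 : ℝ) * δ ≤ p.2 ∧ p.2 < ((k.2 : ℝ) + 1) * δ}

/-- The centre of the dyadic cube of side length `δ` with index `k`. -/
def cubeCtr (δ : ℝ) (k : CubeIdx) : Param :=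
  (mk2 (((k.1.1 : ℝ) + 1 / 2) * δ) (((k.1.2 : ℝ) + 1 / 2) * δ), ((k.2 : ℝ) + 1 / 2) * δ)

/-- The unit vector with angle `θ`. -/
def dir (θ : ℝ) : Plane := mk2 (Real.cos θ) (Real.sin θ)

/-- The `j`-th (half-open) arc of the partition `𝒮_σ(p)` of the circle `S(p)`
into arcs of length `2πrσ`. -/
def arcSet (p : Param) (σ : ℝ) (j : ℤ) : Set Plane :=
  {w | ∃ θ : ℝ, (j : ℝ) * (2 * Real.pi * σ) ≤ θ ∧ θ < ((j : ℝ) + 1) * (2 * Real.pi * σ) ∧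
    w = p.1 + p.2 • dir θ}

/-- The centre of the `j`-th arc of `𝒮_σ(p)`. -/
def arcCenterAt (p : Param) (σ : ℝ) (j : ℤ) : Plane :=
  p.1 + p.2 • dir (((j : ℝ) + 1 / 2) * (2 * Real.pi * σ))

/-- Valid indices for the arcs of `𝒮_σ(p)`. -/
def validArc (σ : ℝ) (j : ℤ) : Prop := 0 ≤ j ∧ (j : ℝ) < σ⁻¹

/-- The (one-sided) cone `V(p, I)` centred at the centre of `p` and spanned by `I`. -/
def cone (p : Param) (I : Set Plane) : Set Plane :=
  {x | ∃ e ∈ I, ∃ t : ℝ, 0 ≤ t ∧ x = p.1 + t • (e - p.1)}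

/-- A pair: (index of a dyadic cube in `ℝ³`, index of an arc). -/
abbrev DPair := CubeIdx × ℤ

/-- The relation `(p,v) ≺ (𝐩,𝐯)` between pairs at scales `(δ,σ)` and `(Δ,Σ)`. -/
def prec (δ σ Δ Sg : ℝ) (ω W : DPair) : Prop :=
  cubeSet δ ω.1 ⊆ cubeSet Δ W.1 ∧
  arcCenterAt (cubeCtr δ ω.1) σ ω.2 ∈ cone (cubeCtr Δ W.1) (arcSet (cubeCtr Δ W.1) Sg W.2)

/-- The `(Δ,Σ)`-skeleton `Ω^Δ_Σ` of a set of pairs at scales `(δ,σ)`. -/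
def skeleton (δ σ Δ Sg : ℝ) (Ω : Set DPair) : Set DPair :=
  {W | cubeSet Δ W.1 ⊆ domD ∧ validArc Sg W.2 ∧ ∃ ω ∈ Ω, prec δ σ Δ Sg ω W}

/-- The cube family `P` of a configuration. -/
def configP (Ω : Set DPair) : Set CubeIdx := Prod.fst '' Ω

/-- The arc family `E_σ(p)` of a configuration. -/
def configE (Ω : Set DPair) (k : CubeIdx) : Set ℤ := {j | (k, j) ∈ Ω}

/-- A (dyadic) `(δ,σ,s,C,M)`-configuration. -/
def IsConfigD (δ σ s C : ℝ) (M : ℕ) (Ω : Set DPair) : Prop :=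
  (configP Ω).Nonempty ∧
  (∀ k ∈ configP Ω, cubeSet δ k ⊆ domD) ∧
  IsDSet3 δ s C (⋃ k ∈ configP Ω, cubeSet δ k) ∧
  ∀ k ∈ configP Ω,
    (∀ j ∈ configE Ω k, validArc σ j) ∧
    IsDSet2 σ s C (⋃ j ∈ configE Ω k, arcSet (cubeCtr δ k) σ j) ∧
    Nat.card (configE Ω k) = M

/-- The partial multiplicity function `m^{ρ_λ,ρ_t,C}_{Δ,λ,t}(ω ∣ G)`, counting pairs in the
`(Δ, σa)`-skeleton of `G`; the geometric data of `ω` is given by the circle parameter `pω`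
(the centre of the cube of `ω`) and the arc centre `vω`. -/
def pMult (baseδ baseσ Δ σa lam t ρl ρt C : ℝ) (G : Set DPair) (pω : Param) (vω : Plane) : ℕ :=
  Nat.card {ω' : DPair | ω' ∈ skeleton baseδ baseσ Δ σa G ∧
    (lam ≤ ρl * Δ ∨ lam / ρl ≤ tang pω (cubeCtr Δ ω'.1)) ∧
    tang pω (cubeCtr Δ ω'.1) ≤ ρl * lam ∧
    t / ρt ≤ pdist pω (cubeCtr Δ ω'.1) ∧
    pdist pω (cubeCtr Δ ω'.1) ≤ ρt * t ∧
    (rect (C * Δ) (C * σa) pω vω ∩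
      rect (C * Δ) (C * σa) (cubeCtr Δ ω'.1) (arcCenterAt (cubeCtr Δ ω'.1) σa ω'.2)).Nonempty}

/-- A `δ`-separated set in `ℝ³ = ℝ² × ℝ`. -/
def sep3 (δ : ℝ) (A : Set Param) : Prop := ∀ p ∈ A, ∀ q ∈ A, p ≠ q → δ ≤ pdist p q

/-- A `(δ,ε)`-almost `t`-bipartite pair. -/
def AlmostBipartite (δ ε t : ℝ) (W B : Set Param) : Prop :=
  sep3 δ W ∧ sep3 δ B ∧ (∀ p ∈ W, ∀ q ∈ B, δ ^ ε * t ≤ pdist p q) ∧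
    ∀ p ∈ W ∪ B, ∀ q ∈ W ∪ B, pdist p q ≤ δ ^ (-ε) * t

/-- A `t`-bipartite pair (relative to the scale `δ`). -/
def Bipartite (δ t : ℝ) (W B : Set Param) : Prop :=
  sep3 δ W ∧ sep3 δ B ∧
  (∀ p ∈ W, ∀ q ∈ W, pdist p q ≤ t) ∧ (∀ p ∈ B, ∀ q ∈ B, pdist p q ≤ t) ∧
  (∀ p ∈ B, ∀ q ∈ W, t ≤ pdist p q) ∧
  ∀ p ∈ W ∪ B, ∀ q ∈ W ∪ B, pdist p q ≤ 100 * t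

def FF (p : Param) (w : Plane) : ℝ := (w 0 - p.1 0) ^ 2 + (w 1 - p.1 1) ^ 2 - p.2 ^ 2

lemma dist_sq2 (w x : Plane) : dist w x ^ 2 = (w 0 - x 0) ^ 2 + (w 1 - x 1) ^ 2 := by
  rw [EuclideanSpace.dist_eq, Real.sq_sqrt (by positivity)]
  simp [Fin.sum_univ_two, Real.dist_eq, sq_abs]

lemma infDist_circ (p : Param) (hp : 0 < p.2) (w : Plane) :
    Metric.infDist w (circ p) = |dist w p.1 - p.2| := by
  have hne : (circ p).Nonempty := NormedSpace.sphere_nonempty.2 hp.le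
  apply le_antisymm
  · by_cases h : w = p.1
    · obtain ⟨y, hy⟩ := hne
      refine (Metric.infDist_le_dist_of_mem hy).trans ?_
      have hy2 : dist y p.1 = p.2 := hy
      rw [h, dist_comm, hy2]
      simp [abs_of_pos hp]
    · have hd : 0 < dist w p.1 := dist_pos.2 h
      have hn : ‖w - p.1‖ = dist w p.1 := (dist_eq_norm _ _).symm
      have hy : p.1 + (p.2 / dist w p.1) • (w - p.1) ∈ circ p := by
        simp only [circ, Metric.mem_sphere, dist_eq_norm, add_sub_cancel_left, norm_smul,
          Real.norm_eq_abs, abs_div, abs_norm]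
        rw [hn, abs_of_pos hp]
        field_simp
      refine (Metric.infDist_le_dist_of_mem hy).trans (le_of_eq ?_)
      have : w - (p.1 + (p.2 / dist w p.1) • (w - p.1)) =
          (1 - p.2 / dist w p.1) • (w - p.1) := by
        rw [sub_smul, one_smul]; abel
      rw [dist_eq_norm, this, norm_smul, hn, Real.norm_eq_abs]
      nth_rewrite 2 [← abs_of_pos hd]
      rw [← abs_mul]
      congr 1
      field_simp
  · rw [Metric.le_infDist hne]
    intro y hy
    have hy2 : dist y p.1 = p.2 := hy
    rw [← hy2]
    exact abs_dist_sub_le w y p.1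

lemma FF_eq (p : Param) (w : Plane) : FF p w = (dist w p.1 - p.2) * (dist w p.1 + p.2) := by
  unfold FF; rw [← dist_sq2]; ring

lemma FF_le_of_annulus {p : Param} (hp : 0 < p.2) {w : Plane} {D M : ℝ} (hw : w ∈ annulus D p)
    (hM : dist w p.1 + p.2 ≤ M) : |FF p w| ≤ D * M := by
  have h1 : |dist w p.1 - p.2| ≤ D := by rw [← infDist_circ p hp]; exact hw
  have h2 : 0 ≤ dist w p.1 + p.2 := by positivity
  rw [FF_eq, abs_mul, abs_of_nonneg h2]
  have := abs_nonneg (dist w p.1 - p.2)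
  gcongr
  linarith

lemma annulus_of_FF {p : Param} (hp : 1 / 2 ≤ p.2) {w : Plane} {D : ℝ}
    (h : |FF p w| ≤ D / 2) : w ∈ annulus D p := by
  show Metric.infDist w (circ p) ≤ D
  rw [infDist_circ p (by linarith)]
  rw [FF_eq, abs_mul] at h
  have h2 : (1:ℝ) / 2 ≤ |dist w p.1 + p.2| := by
    rw [abs_of_nonneg (by positivity)]
    have : 0 ≤ dist w p.1 := dist_nonneg
    linarith
  have := abs_nonneg (dist w p.1 - p.2)
  nlinarith

lemma rectData {p : Param} {v : Plane} (h : IsRectData (p, v)) :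
    ∃ e f : ℝ, e ^ 2 + f ^ 2 = 1 ∧ v 0 = p.1 0 + p.2 * e ∧ v 1 = p.1 1 + p.2 * f := by
  obtain ⟨⟨h1, h2, h3⟩, h4⟩ := h
  have h4 : dist v p.1 = p.2 := h4
  have h5 := dist_sq2 v p.1
  rw [h4] at h5
  simp only at h2
  have hp : 0 < p.2 := by linarith
  refine ⟨(v 0 - p.1 0) / p.2, (v 1 - p.1 1) / p.2, ?_, ?_, ?_⟩
  · rw [div_pow, div_pow, ← add_div, ← h5]; field_simp
  · field_simp; ring
  · field_simp; ring

lemma domD_bd {p : Param} (h : p ∈ domD) : (p.1 0) ^ 2 + (p.1 1) ^ 2 ≤ 1 / 16 := by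
  have h1 := h.1
  have h2 := dist_sq2 p.1 0
  rw [dist_zero_right] at h2
  simp at h2
  nlinarith [norm_nonneg p.1]

lemma three_pt {δ σ K : ℝ} {p : Param} {v : Plane} {e f c0 c1 c2 : ℝ}
    (hδ : 0 < δ) (hσ : 0 < σ) (hσ1 : σ ≤ 1)
    (hd : IsRectData (p, v)) (hef : e ^ 2 + f ^ 2 = 1) (hv0 : v 0 = p.1 0 + p.2 * e)
    (hv1 : v 1 = p.1 1 + p.2 * f)
    (hK : ∀ w ∈ rect δ σ p v, |c0 + c1 * w 0 + c2 * w 1| ≤ K) :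
    |c0 + c1 * v 0 + c2 * v 1| ≤ K ∧ |-c1 * f + c2 * e| * σ ≤ 3 * K ∧
      |c1 * e + c2 * f| * σ ^ 2 ≤ 16 * K := by
  obtain ⟨⟨-, hr1, hr2⟩, -⟩ := hd
  simp only at hr1 hr2
  have hr : 0 < p.2 := by linarith
  have key : ∀ s t : ℝ, s ^ 2 + t ^ 2 + 2 * p.2 * t = 0 → s ^ 2 + t ^ 2 ≤ σ ^ 2 →
      |(c0 + c1 * v 0 + c2 * v 1) + (-c1 * f + c2 * e) * s + (c1 * e + c2 * f) * t| ≤ K := by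
    intro s t h1 h2
    have hw : (!₂[v 0 - s * f + t * e, v 1 + s * e + t * f] : Plane) ∈ rect δ σ p v := by
      constructor
      · apply annulus_of_FF hr1
        have : FF p (!₂[v 0 - s * f + t * e, v 1 + s * e + t * f] : Plane) = 0 := by
          simp [FF]
          rw [hv0, hv1]
          linear_combination h1 + (s ^ 2 + (t + p.2) ^ 2) * hef
        rw [this, abs_zero]; positivity
      · rw [Metric.mem_closedBall]
        apply abs_le_of_sq_le_sq' _ hσ.le |>.2
        rw [dist_sq2]
        simp
        nlinarith [hef]
    have := hK _ hw
    simp at this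
    convert this using 2
    ring
  have k0 := key 0 0 (by ring) (by nlinarith)
  set H := c0 + c1 * v 0 + c2 * v 1
  set a := -c1 * f + c2 * e
  set b := c1 * e + c2 * f
  obtain ⟨u, hu⟩ : ∃ u : ℝ, u = (σ / 2) ^ 2 / (2 * p.2) := ⟨_, rfl⟩
  have hu1 : 2 * p.2 * u = (σ / 2) ^ 2 := by rw [hu]; field_simp
  have hu0 : 0 < u := by rw [hu]; positivity
  have hu2 : σ ^ 2 / 8 ≤ u := by nlinarith
  have hu3 : u ≤ σ ^ 2 / 4 := by nlinarith
  have hu4 : u ≤ σ / 4 := by nlinarith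
  have hu5 : u ^ 2 ≤ (σ / 4) ^ 2 := by gcongr
  have hpos : σ ^ 2 / 9 ≤ (σ / 2) ^ 2 - u ^ 2 := by nlinarith [sq_nonneg σ]
  obtain ⟨s, hs0, hs⟩ : ∃ s : ℝ, 0 ≤ s ∧ s ^ 2 = (σ / 2) ^ 2 - u ^ 2 :=
    ⟨_, Real.sqrt_nonneg _, Real.sq_sqrt (le_trans (by positivity) hpos)⟩
  have hs3 : σ / 3 ≤ s := by nlinarith
  have k1 := key s (-u) (by nlinarith) (by nlinarith)
  have k2 := key (-s) (-u) (by nlinarith) (by nlinarith)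
  rw [abs_le] at k0 k1 k2
  have ha : |a| * s ≤ K := by
    rw [← abs_of_nonneg hs0, ← abs_mul, abs_le]
    constructor <;> linarith [k1.1, k1.2, k2.1, k2.2]
  have hb : |b| * u ≤ 2 * K := by
    rw [← abs_of_nonneg hu0.le, ← abs_mul, abs_le]
    constructor <;> linarith [k1.1, k1.2, k2.1, k2.2, k0.1, k0.2]
  refine ⟨by rw [abs_le]; constructor <;> linarith [k0.1, k0.2], ?_, ?_⟩
  · have := mul_le_mul_of_nonneg_left hs3 (abs_nonneg a)
    linarith
  · have := mul_le_mul_of_nonneg_left hu2 (abs_nonneg b)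
    linarith

lemma three_pt' {δ σ K : ℝ} {p q : Param} {v : Plane} {e f : ℝ}
    (hδ : 0 < δ) (hσ : 0 < σ) (hσ1 : σ ≤ 1)
    (hd : IsRectData (p, v)) (hq : q ∈ domD)
    (hef : e ^ 2 + f ^ 2 = 1) (hv0 : v 0 = p.1 0 + p.2 * e)
    (hv1 : v 1 = p.1 1 + p.2 * f)
    (hK : ∀ w ∈ rect δ σ p v, |FF q w - FF p w| ≤ K) :
    |FF q v| ≤ K ∧
    |2 * (q.1 0 - p.1 0) * f - 2 * (q.1 1 - p.1 1) * e| * σ ≤ 3 * K ∧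
      |2 * (q.1 0 - p.1 0) * e + 2 * (q.1 1 - p.1 1) * f| * σ ^ 2 ≤ 16 * K ∧
      |2 * (q.1 0 - p.1 0) * e + 2 * (q.1 1 - p.1 1) * f| ≤ 1 := by
  have hz : FF p v = 0 := by
    unfold FF; rw [hv0, hv1]; linear_combination p.2 ^ 2 * hef
  have H := three_pt (c0 := FF q 0 - FF p 0) (c1 := - 2 * (q.1 0 - p.1 0))
    (c2 := - 2 * (q.1 1 - p.1 1)) (K := K) hδ hσ hσ1 hd hef hv0 hv1 (by
      intro w hw
      convert hK w hw using 2
      simp [FF]; ring)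
  obtain ⟨h1, h2, h3⟩ := H
  refine ⟨?_, ?_, ?_, ?_⟩
  · convert h1 using 2
    rw [← sub_zero (FF q v), ← hz]
    simp [FF]; ring
  · convert h2 using 3
    ring
  · rw [← abs_neg]
    convert h3 using 3
    ring
  · have b1 := domD_bd hd.1
    have b2 := domD_bd hq
    simp only at b1
    rw [← sq_le_one_iff_abs_le_one]
    set x := q.1 0 - p.1 0 with hx
    set y := q.1 1 - p.1 1 with hy
    have h5 : x ^ 2 + y ^ 2 ≤ 1 / 4 := by
      nlinarith [sq_nonneg (q.1 0 + p.1 0), sq_nonneg (q.1 1 + p.1 1)]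
    nlinarith [sq_nonneg (x * f - y * e)]

lemma dist_bd {p q : Param} {v w : Plane} {σ : ℝ} (hσ1 : σ ≤ 1) (hd : IsRectData (p, v))
    (hq : q ∈ domD) (hw : dist w v ≤ σ) : dist w q.1 + q.2 ≤ 4 := by
  have h1 : dist v p.1 = p.2 := hd.2
  have h2 := hd.1.2.2
  have h3 := hq.2.2
  have h4 : dist p.1 0 ≤ 1 / 4 := by rw [dist_zero_right]; exact hd.1.1
  have h5 : dist q.1 0 ≤ 1 / 4 := by rw [dist_zero_right]; exact hq.1
  have h6 := dist_triangle w v q.1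
  have h7 := dist_triangle v p.1 q.1
  have h8 := dist_triangle_right p.1 q.1 0
  simp only at h2
  linarith

lemma self_bd {p : Param} {v w : Plane} {δ σ : ℝ} (hδ : 0 < δ) (hδ1 : δ ≤ 1)
    (hd : IsRectData (p, v))
    (hw : w ∈ rect δ σ p v) : |FF p w| ≤ 3 * δ := by
  have hp : 0 < p.2 := by have := hd.1.2.1; simp only at this; linarith
  have h1 : |dist w p.1 - p.2| ≤ δ := by rw [← infDist_circ p hp]; exact hw.1
  have := hd.1.2.2
  simp only at this
  have := FF_le_of_annulus hp hw.1 (M := 3) (by linarith [(abs_le.1 h1).2])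
  linarith

set_option maxHeartbeats 1600000 in
/-- extension lemma -/
lemma extend {A δ σ : ℝ} (hA : 100 ≤ A) (hδ : 0 < δ) (hδσ : δ ≤ σ) (hσ1 : σ ≤ 1)
    {p q : Param} {v w : Plane} {e f : ℝ}
    (hd : IsRectData (p, v)) (hq : q ∈ domD)
    (hef : e ^ 2 + f ^ 2 = 1) (hv0 : v 0 = p.1 0 + p.2 * e)
    (hv1 : v 1 = p.1 1 + p.2 * f)
    (hsub : ∀ w ∈ rect δ σ p v, |FF q w| ≤ 5 * A * δ)
    (hw : dist w v ≤ 2 * A * σ) (hwq : |FF q w| ≤ 5 * A * δ) :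
    |-(w 0 - v 0) * f + (w 1 - v 1) * e| ≤ 2 * A * σ ∧
    |(w 0 - v 0) * e + (w 1 - v 1) * f| ≤ 400 * A ^ 2 * (σ ^ 2 + δ) ∧
    |FF p w| ≤ 40000 * A ^ 3 * δ := by
  have hσ : 0 < σ := by linarith
  have hA0 : 0 < A := by linarith
  have hr1 := hd.1.2.1
  have hr2 := hd.1.2.2
  have hq1 := hq.2.1
  simp only at hr1 hr2
  obtain ⟨k1, k2, k3, k4⟩ := three_pt' (K := 6 * A * δ) hδ hσ hσ1 hd hq hef hv0 hv1 (by
    intro w hw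
    have h1 := self_bd hδ (by linarith) hd hw
    have h2 := hsub w hw
    have := abs_sub (FF q w) (FF p w)
    nlinarith)
  obtain ⟨s, hs⟩ : ∃ s, s = -(w 0 - v 0) * f + (w 1 - v 1) * e := ⟨_, rfl⟩
  obtain ⟨t, ht⟩ : ∃ t, t = (w 0 - v 0) * e + (w 1 - v 1) * f := ⟨_, rfl⟩
  obtain ⟨a, ha⟩ : ∃ a, a = 2 * (q.1 0 - p.1 0) * f - 2 * (q.1 1 - p.1 1) * e := ⟨_, rfl⟩
  obtain ⟨b, hb⟩ : ∃ b, b = 2 * (q.1 0 - p.1 0) * e + 2 * (q.1 1 - p.1 1) * f := ⟨_, rfl⟩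
  rw [← hs, ← ht]
  rw [← ha] at k2
  rw [← hb] at k3 k4
  have hw0 : w 0 = v 0 - s * f + t * e := by
    rw [hs, ht]; linear_combination (-(w 0 - v 0)) * hef
  have hw1 : w 1 = v 1 + s * e + t * f := by
    rw [hs, ht]; linear_combination (-(w 1 - v 1)) * hef
  have hst : s ^ 2 + t ^ 2 ≤ (2 * A * σ) ^ 2 := by
    have : dist w v ^ 2 ≤ (2 * A * σ) ^ 2 := by gcongr
    rw [dist_sq2] at this
    refine le_trans (le_of_eq ?_) this
    rw [hs, ht]
    linear_combination ((w 0 - v 0) ^ 2 + (w 1 - v 1) ^ 2) * hef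
  have hAσ : 0 < A * σ := by positivity
  have hAδ : 0 < A * δ := by positivity
  have hAδσ : A * δ ≤ A * σ := by gcongr
  have hs1 : |s| ≤ 2 * A * σ := abs_le_of_sq_le_sq (by nlinarith [sq_nonneg t]) (by positivity)
  have ht1 : |t| ≤ 2 * A * σ := abs_le_of_sq_le_sq (by nlinarith [sq_nonneg s]) (by positivity)
  have hFp : FF p w = s ^ 2 + t ^ 2 + 2 * p.2 * t := by
    unfold FF; rw [hw0, hw1, hv0, hv1]; linear_combination (s ^ 2 + (t + p.2) ^ 2) * hef
  have hFq : FF q w = FF p w + FF q v + a * s - b * t := by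
    unfold FF; rw [hw0, hw1, hv0, hv1, ha, hb]
    linear_combination (- p.2 ^ 2) * hef
  have has : |a * s| ≤ 36 * A ^ 2 * δ := by
    rw [abs_mul]
    calc |a| * |s| ≤ |a| * (2 * A * σ) := by gcongr
      _ = (|a| * σ) * (2 * A) := by ring
      _ ≤ (3 * (6 * A * δ)) * (2 * A) := by gcongr
      _ = _ := by ring
  have hA2 : A * δ ≤ A ^ 2 * δ := by nlinarith
  have hA3 : A ^ 2 * δ ≤ A ^ 3 * δ := by
    have : 0 < A ^ 2 * δ := by positivity
    nlinarith
  have htt : |t| ≤ 400 * A ^ 2 * (σ ^ 2 + δ) := by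
    have p1 : 0 < A ^ 2 * δ := by positivity
    have p2 : 0 < A ^ 2 * σ ^ 2 := by positivity
    by_cases c1 : 1 / 200 ≤ A * σ
    · have := mul_le_mul_of_nonneg_left c1 hAσ.le
      linarith
    by_cases c2 : σ ≤ 90 * A * δ
    · have := mul_le_mul_of_nonneg_left c2 hA0.le
      linarith
    push Not at c1 c2
    have ha5 : |a| ≤ 1 / 5 := le_of_mul_le_mul_right (by linarith) hσ
    have hv : FF q v + q.2 ^ 2 = (a / 2) ^ 2 + (p.2 - b / 2) ^ 2 := by
      unfold FF; rw [hv0, hv1, ha, hb]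
      linear_combination (p.2 ^ 2 - (q.1 0 - p.1 0) ^ 2 - (q.1 1 - p.1 1) ^ 2) * hef
    have hb2 : (1:ℝ) / 5 ≤ (p.2 - b / 2) ^ 2 := by
      have g1 := sq_le_sq' (abs_le.1 ha5).1 (abs_le.1 ha5).2
      have g2 := (abs_le.1 k1).1
      have g3 : (1 / 2 : ℝ) ^ 2 ≤ q.2 ^ 2 := by gcongr
      linarith
    have hb3 : (2 / 5 : ℝ) ≤ |p.2 - b / 2| := by
      rw [← sq_abs] at hb2
      nlinarith [abs_nonneg (p.2 - b / 2)]
    have hb4 : (1 / 2 : ℝ) ≤ |t + 2 * p.2 - b| := by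
      have h1 := abs_sub_abs_le_abs_sub (2 * (p.2 - b / 2)) (-t)
      rw [abs_mul, abs_neg, abs_two] at h1
      have h2 : 2 * (p.2 - b / 2) - -t = t + 2 * p.2 - b := by ring
      rw [h2] at h1
      linarith
    have hprod : |t| * |t + 2 * p.2 - b| ≤ 50 * A ^ 2 * (σ ^ 2 + δ) := by
      rw [← abs_mul]
      have : t * (t + 2 * p.2 - b) = FF q w - FF q v - a * s - s ^ 2 := by
        rw [hFq, hFp]; ring
      rw [this]
      have hs2 : s ^ 2 ≤ 4 * A ^ 2 * σ ^ 2 := by linarith [sq_nonneg t]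
      have q1 := abs_le.1 hwq
      have q2 := abs_le.1 k1
      have q3 := abs_le.1 has
      have q4 := sq_nonneg s
      rw [abs_le]
      constructor <;> linarith [q1.1, q1.2, q2.1, q2.2, q3.1, q3.2]
    have := mul_le_mul_of_nonneg_left hb4 (abs_nonneg t)
    linarith
  refine ⟨hs1, htt, ?_⟩
  have hbt : |b * t| ≤ 38800 * A ^ 3 * δ := by
    rw [abs_mul]
    calc |b| * |t| ≤ |b| * (400 * A ^ 2 * (σ ^ 2 + δ)) := by gcongr
      _ = 400 * A ^ 2 * (|b| * σ ^ 2 + |b| * δ) := by ring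
      _ ≤ 400 * A ^ 2 * (16 * (6 * A * δ) + A * δ) := by
        gcongr
        linarith
      _ = _ := by ring
  have : FF p w = FF q w - FF q v - a * s + b * t := by rw [hFq]; ring
  rw [this]
  have q1 := abs_le.1 hwq
  have q2 := abs_le.1 k1
  have q3 := abs_le.1 has
  have q4 := abs_le.1 hbt
  rw [abs_le]
  constructor <;> linarith [q1.1, q1.2, q2.1, q2.2, q3.1, q3.2, q4.1, q4.2]

/-- information from comparability -/
lemma comp_info {A δ σ : ℝ} (hA : 100 ≤ A) (hδ : 0 < δ) (hδσ : δ ≤ σ) (hσ1 : σ ≤ 1)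
    {p p0 : Param} {v v0 : Plane} {e f : ℝ}
    (hd : IsRectData (p, v)) (hd0 : IsRectData (p0, v0))
    (hef : e ^ 2 + f ^ 2 = 1) (hv0 : v0 0 = p0.1 0 + p0.2 * e)
    (hv1 : v0 1 = p0.1 1 + p0.2 * f) (hc : Comp δ σ A (p, v) (p0, v0)) :
    dist v v0 ≤ 2 * A * σ ∧
    (∀ w ∈ rect δ σ p v, |-(w 0 - v0 0) * f + (w 1 - v0 1) * e| ≤ 2 * A * σ ∧
      |(w 0 - v0 0) * e + (w 1 - v0 1) * f| ≤ 400 * A ^ 2 * (σ ^ 2 + δ)) ∧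
    |FF p v0| ≤ 40001 * A ^ 3 * δ ∧
    |2 * (p.1 0 - p0.1 0) * f - 2 * (p.1 1 - p0.1 1) * e| * σ ≤ 3 * (40001 * A ^ 3 * δ) ∧
    |2 * (p.1 0 - p0.1 0) * e + 2 * (p.1 1 - p0.1 1) * f| * σ ^ 2 ≤ 16 * (40001 * A ^ 3 * δ) ∧
    |2 * (p.1 0 - p0.1 0) * e + 2 * (p.1 1 - p0.1 1) * f| ≤ 1 := by
  have hσ : 0 < σ := by linarith
  obtain ⟨⟨q, u⟩, ⟨hq, -⟩, hsub⟩ := hc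
  simp only [Set.union_subset_iff] at hsub
  obtain ⟨hs1, hs2⟩ := hsub
  simp only at hq
  have hqp : 0 < q.2 := by have := hq.2.1; linarith
  have mem_self : ∀ p v, IsRectData (p, v) → v ∈ rect δ σ p v := by
    intro p v h
    refine ⟨?_, Metric.mem_closedBall_self hσ.le⟩
    show Metric.infDist v (circ p) ≤ δ
    rw [Metric.infDist_zero_of_mem h.2]; exact hδ.le
  have bnd : ∀ p v, IsRectData (p, v) → rect δ σ p v ⊆ rect (A * δ) (A * σ) q u →
      ∀ w ∈ rect δ σ p v, |FF q w| ≤ 5 * A * δ := by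
    intro p v h hs w hw
    have := FF_le_of_annulus hqp (hs hw).1 (dist_bd hσ1 h hq hw.2)
    have : 0 < A * δ := by positivity
    linarith
  have dd : ∀ w w', w ∈ rect (A * δ) (A * σ) q u → w' ∈ rect (A * δ) (A * σ) q u →
      dist w w' ≤ 2 * A * σ := by
    intro w w' h h'
    have h1 : dist w u ≤ A * σ := h.2
    have h2 : dist w' u ≤ A * σ := h'.2
    linarith [dist_triangle_right w w' u]
  have m := mem_self p v hd
  have m0 := mem_self p0 v0 hd0
  refine ⟨dd _ _ (hs1 m) (hs2 m0), ?_, ?_⟩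
  · intro w hw
    have := extend hA hδ hδσ hσ1 hd0 hq hef hv0 hv1 (bnd _ _ hd0 hs2)
      (dd _ _ (hs1 hw) (hs2 m0)) (bnd _ _ hd hs1 w hw)
    exact ⟨this.1, this.2.1⟩
  · apply three_pt' hδ hσ hσ1 hd0 hd.1 hef hv0 hv1
    intro w hw
    obtain ⟨e', f', h1, h2, h3⟩ := rectData hd
    have h4 := (extend hA hδ hδσ hσ1 hd hq h1 h2 h3 (bnd _ _ hd hs1)
      (dd _ _ (hs2 hw) (hs1 m)) (bnd _ _ hd0 hs2 w hw)).2.2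
    have h5 := self_bd hδ (by linarith) hd0 hw
    have h6 := abs_sub (FF p w) (FF p0 w)
    have h7 : 3 * δ ≤ A ^ 3 * δ := by
      have : (3:ℝ) ≤ A ^ 3 := by nlinarith [sq_nonneg A]
      gcongr
    linarith

lemma floor_close {x y : ℝ} (h : ⌊x⌋ = ⌊y⌋) : |x - y| ≤ 1 :=
  (Int.abs_sub_lt_one_of_floor_eq_floor h).le

lemma abs_div_close {x y d : ℝ} (hd : 0 < d) (h : ⌊x / d⌋ = ⌊y / d⌋) : |x - y| ≤ d := by
  have := floor_close h
  rw [← sub_div, abs_div, abs_of_pos hd, div_le_one hd] at this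
  exact this

def par (A δ σ : ℝ) (p0 : Param) (v0 : Plane) (e f : ℝ) (r : Param × Plane) : Fin 5 → ℝ :=
  ![(r.2 0 - v0 0) / σ, (r.2 1 - v0 1) / σ, FF r.1 v0 / δ,
    (2 * (r.1.1 0 - p0.1 0) * f - 2 * (r.1.1 1 - p0.1 1) * e) / (δ / (σ * A)),
    (2 * (r.1.1 0 - p0.1 0) * e + 2 * (r.1.1 1 - p0.1 1) * f) /
      (δ / ((σ ^ 2 + δ) * (400 * A ^ 2)))]

lemma par_bd {A δ σ : ℝ} (hA : 100 ≤ A) (hδ : 0 < δ) (hδσ : δ ≤ σ) (hσ1 : σ ≤ 1)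
    {p p0 : Param} {v v0 : Plane} {e f : ℝ}
    (hd : IsRectData (p, v)) (hd0 : IsRectData (p0, v0))
    (hef : e ^ 2 + f ^ 2 = 1) (hv0 : v0 0 = p0.1 0 + p0.2 * e)
    (hv1 : v0 1 = p0.1 1 + p0.2 * f) (hc : Comp δ σ A (p, v) (p0, v0)) (i : Fin 5) :
    |par A δ σ p0 v0 e f (p, v) i| ≤ A ^ 10 := by
  obtain ⟨h1, -, h3, h4, h5, h6⟩ := comp_info hA hδ hδσ hσ1 hd hd0 hef hv0 hv1 hc
  have hσ : 0 < σ := by linarith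
  have hA0 : 0 < A := by linarith
  have e5 : (100:ℝ) ^ 5 ≤ A ^ 5 := by gcongr
  have e7 : (100:ℝ) ^ 7 ≤ A ^ 7 := by gcongr
  have e9 : (100:ℝ) ^ 9 ≤ A ^ 9 := by gcongr
  have e6 : (100:ℝ) ^ 6 ≤ A ^ 6 := by gcongr
  have p1 : 2 * A ≤ A ^ 10 := by
    have : A ^ 10 = A ^ 9 * A := by ring
    rw [this]; gcongr; linarith
  have p3 : 40001 * A ^ 3 ≤ A ^ 10 := by
    have : A ^ 10 = A ^ 7 * A ^ 3 := by ring
    rw [this]; gcongr; linarith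
  have p4 : 3 * 40001 * A ^ 4 ≤ A ^ 10 := by
    have : A ^ 10 = A ^ 6 * A ^ 4 := by ring
    rw [this]; gcongr; linarith
  have p5 : 400 * 640017 * A ^ 5 ≤ A ^ 10 := by
    have : A ^ 10 = A ^ 5 * A ^ 5 := by ring
    rw [this]; gcongr; linarith
  have hv : ∀ x : ℝ, x ^ 2 ≤ dist v v0 ^ 2 → |x / σ| ≤ A ^ 10 := by
    intro x hx
    rw [abs_div, abs_of_pos hσ, div_le_iff₀ hσ]
    have : |x| ≤ dist v v0 := abs_le_of_sq_le_sq hx dist_nonneg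
    nlinarith
  have hdd := dist_sq2 v v0
  fin_cases i
  · exact hv _ (by rw [hdd]; simp; positivity)
  · exact hv _ (by rw [hdd]; simp; positivity)
  · show |FF p v0 / δ| ≤ _
    rw [abs_div, abs_of_pos hδ, div_le_iff₀ hδ]
    nlinarith
  · show |_ / (δ / (σ * A))| ≤ _
    rw [abs_div, abs_of_pos (a := δ / (σ * A)) (by positivity), div_div_eq_mul_div, div_le_iff₀ hδ]
    simp only
    generalize |2 * (p.1 0 - p0.1 0) * f - 2 * (p.1 1 - p0.1 1) * e| = a at *
    calc a * (σ * A) = (a * σ) * A := by ring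
      _ ≤ (3 * (40001 * A ^ 3 * δ)) * A := by gcongr
      _ = (3 * 40001 * A ^ 4) * δ := by ring
      _ ≤ _ := by gcongr
  · show |_ / (δ / ((σ ^ 2 + δ) * (400 * A ^ 2)))| ≤ _
    rw [abs_div, abs_of_pos (a := δ / ((σ ^ 2 + δ) * (400 * A ^ 2))) (by positivity),
      div_div_eq_mul_div, div_le_iff₀ hδ]
    simp only
    generalize |2 * (p.1 0 - p0.1 0) * e + 2 * (p.1 1 - p0.1 1) * f| = a at *
    have h7 : δ ≤ A ^ 3 * δ := by
      have : (1:ℝ) ≤ A ^ 3 := one_le_pow₀ (by linarith)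
      nlinarith
    calc a * ((σ ^ 2 + δ) * (400 * A ^ 2)) = (a * σ ^ 2 + a * δ) * (400 * A ^ 2) := by ring
      _ ≤ (16 * (40001 * A ^ 3 * δ) + A ^ 3 * δ) * (400 * A ^ 2) := by
        gcongr
        nlinarith
      _ = (400 * 640017 * A ^ 5) * δ := by ring
      _ ≤ _ := by gcongr

lemma par_inj {A δ σ : ℝ} (hA : 100 ≤ A) (hδ : 0 < δ) (hδσ : δ ≤ σ) (hσ1 : σ ≤ 1)
    {p p' p0 : Param} {v v' v0 : Plane} {e f : ℝ}
    (hd : IsRectData (p, v)) (hd' : IsRectData (p', v')) (hd0 : IsRectData (p0, v0))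
    (hef : e ^ 2 + f ^ 2 = 1) (hv0 : v0 0 = p0.1 0 + p0.2 * e)
    (hv1 : v0 1 = p0.1 1 + p0.2 * f) (hc : Comp δ σ A (p, v) (p0, v0))
    (h : ∀ i, ⌊par A δ σ p0 v0 e f (p, v) i⌋ = ⌊par A δ σ p0 v0 e f (p', v') i⌋) :
    Comp δ σ 100 (p, v) (p', v') := by
  have hσ : 0 < σ := by linarith
  have hA0 : 0 < A := by linarith
  obtain ⟨-, h2, -⟩ := comp_info hA hδ hδσ hσ1 hd hd0 hef hv0 hv1 hc
  have c0 := abs_div_close hσ (h 0)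
  have c1 := abs_div_close hσ (h 1)
  have c2 := abs_div_close hδ (h 2)
  have c3 := abs_div_close (d := δ / (σ * A)) (by positivity) (h 3)
  have c4 := abs_div_close (d := δ / ((σ ^ 2 + δ) * (400 * A ^ 2))) (by positivity) (h 4)
  simp only at c0 c1 c2 c3 c4
  have hp' : 1 / 2 ≤ p'.2 := hd'.1.2.1
  refine ⟨(p', v'), hd', Set.union_subset ?_ ?_⟩
  · intro w hw
    obtain ⟨i1, i2⟩ := h2 w hw
    have i0 := self_bd hδ (by linarith) hd hw
    constructor
    · apply annulus_of_FF hp'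
      obtain ⟨s, hs⟩ : ∃ s, s = -(w 0 - v0 0) * f + (w 1 - v0 1) * e := ⟨_, rfl⟩
      obtain ⟨t, ht⟩ : ∃ t, t = (w 0 - v0 0) * e + (w 1 - v0 1) * f := ⟨_, rfl⟩
      rw [← hs] at i1
      rw [← ht] at i2
      have hw0 : w 0 = v0 0 - s * f + t * e := by
        rw [hs, ht]; linear_combination (-(w 0 - v0 0)) * hef
      have hw1 : w 1 = v0 1 + s * e + t * f := by
        rw [hs, ht]; linear_combination (-(w 1 - v0 1)) * hef
      obtain ⟨a, ha⟩ : ∃ a, a = 2 * (p.1 0 - p0.1 0) * f - 2 * (p.1 1 - p0.1 1) * e -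
        (2 * (p'.1 0 - p0.1 0) * f - 2 * (p'.1 1 - p0.1 1) * e) := ⟨_, rfl⟩
      obtain ⟨b, hb⟩ : ∃ b, b = 2 * (p.1 0 - p0.1 0) * e + 2 * (p.1 1 - p0.1 1) * f -
        (2 * (p'.1 0 - p0.1 0) * e + 2 * (p'.1 1 - p0.1 1) * f) := ⟨_, rfl⟩
      rw [← ha] at c3
      rw [← hb] at c4
      have key : FF p' w = FF p w - (FF p v0 - FF p' v0) - a * s + b * t := by
        unfold FF; rw [hw0, hw1, ha, hb]; ring
      have has : |a * s| ≤ 2 * δ := by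
        rw [abs_mul]
        calc |a| * |s| ≤ (δ / (σ * A)) * (2 * A * σ) := by gcongr
          _ = 2 * δ := by field_simp
      have hbt : |b * t| ≤ δ := by
        rw [abs_mul]
        calc |b| * |t| ≤ (δ / ((σ ^ 2 + δ) * (400 * A ^ 2))) * (400 * A ^ 2 * (σ ^ 2 + δ)) := by
              gcongr
          _ = δ := by field_simp
      rw [key]
      rw [abs_le] at *
      constructor <;> linarith [c2.1, c2.2, i0.1, i0.2, has.1, has.2, hbt.1, hbt.2]
    · have hwv : dist w v ≤ σ := hw.2
      have hvv : dist v v' ≤ 2 * σ := by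
        apply abs_le_of_sq_le_sq' _ (by positivity) |>.2
        rw [dist_sq2]
        have g0 := sq_le_sq' (abs_le.1 c0).1 (abs_le.1 c0).2
        have g1 := sq_le_sq' (abs_le.1 c1).1 (abs_le.1 c1).2
        nlinarith
      rw [Metric.mem_closedBall]
      linarith [dist_triangle w v v']
  · intro w hw
    have h1 : Metric.infDist w (circ p') ≤ δ := hw.1
    have h2 : dist w v' ≤ σ := hw.2
    exact ⟨show Metric.infDist w (circ p') ≤ 100 * δ by linarith,
      Metric.mem_closedBall.2 (by linarith)⟩

lemma nbr_card {A δ σ : ℝ} (hA : 100 ≤ A) (hδ : 0 < δ) (hδσ : δ ≤ σ) (hσ1 : σ ≤ 1)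
    (N : Finset (Param × Plane)) (r0 : Param × Plane) (hr0 : IsRectData r0)
    (hN : ∀ r ∈ N, IsRectData r) (hc : ∀ r ∈ N, Comp δ σ A r r0)
    (hinc : ∀ r ∈ N, ∀ r' ∈ N, r ≠ r' → ¬ Comp δ σ 100 r r') :
    (N.card : ℝ) ≤ 1024 * A ^ 50 := by
  obtain ⟨p0, v0⟩ := r0
  obtain ⟨e, f, hef, hv0, hv1⟩ := rectData hr0
  set n : ℕ := ⌈A ^ 10⌉₊ + 1 with hn
  have hle : N.card ≤ (Fintype.piFinset (fun _ : Fin 5 => Finset.Ico (-(n:ℤ)) n)).card := by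
    apply Finset.card_le_card_of_injOn (fun r i => ⌊par A δ σ p0 v0 e f r i⌋)
    · rintro ⟨p, v⟩ hr
      simp only [Finset.mem_coe, Fintype.mem_piFinset, Finset.mem_Ico] at hr ⊢
      intro i
      have := par_bd hA hδ hδσ hσ1 (hN _ hr) hr0 hef hv0 hv1 (hc _ hr) i
      rw [abs_le] at this
      have h2 := Nat.le_ceil (A ^ 10)
      constructor
      · rw [Int.le_floor]; push_cast [hn]; linarith
      · rw [Int.floor_lt]; push_cast [hn]; linarith
    · rintro ⟨p, v⟩ hr ⟨p', v'⟩ hr' h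
      by_contra hne
      exact hinc _ hr _ hr' hne (par_inj hA hδ hδσ hσ1 (hN _ hr) (hN _ hr') hr0 hef hv0 hv1
        (hc _ hr) (fun i => congrFun h i))
  have hcard : (Fintype.piFinset (fun _ : Fin 5 => Finset.Ico (-(n:ℤ)) n)).card = (2 * n) ^ 5 := by
    rw [Fintype.card_piFinset]
    simp only [Int.card_Ico, Finset.prod_const, Finset.card_univ, Fintype.card_fin]
    congr 1
    omega
  rw [hcard] at hle
  have hn2 : (n : ℝ) ≤ 2 * A ^ 10 := by
    have h1 := (Nat.ceil_lt_add_one (show 0 ≤ A ^ 10 by positivity)).le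
    have h2 : (100:ℝ) ^ 10 ≤ A ^ 10 := by gcongr
    push_cast [hn]
    linarith
  calc (N.card : ℝ) ≤ ((2 * n) ^ 5 : ℕ) := by exact_mod_cast hle
    _ = (2 * (n:ℝ)) ^ 5 := by push_cast; ring
    _ ≤ (2 * (2 * A ^ 10)) ^ 5 := by gcongr
    _ = _ := by ring

lemma comp_symm {δ σ C : ℝ} {r r' : Param × Plane} (h : Comp δ σ C r r') : Comp δ σ C r' r := by
  obtain ⟨q, hq, hs⟩ := h
  exact ⟨q, hq, by rwa [Set.union_comm]⟩

lemma comp_refl {δ σ C : ℝ} (hC : 1 ≤ C) (hδ : 0 < δ) (hσ : 0 < σ) {r : Param × Plane}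
    (h : IsRectData r) : Comp δ σ C r r := by
  refine ⟨r, h, ?_⟩
  rw [Set.union_self]
  intro w hw
  have h1 : Metric.infDist w (circ r.1) ≤ δ := hw.1
  have h2 : dist w r.2 ≤ σ := hw.2
  exact ⟨show Metric.infDist w (circ r.1) ≤ C * δ by nlinarith,
    Metric.mem_closedBall.2 (by nlinarith)⟩

/-- any family of pairwise `100`-incomparable `(δ,σ)`-rectangles contains
a pairwise `A`-incomparable subfamily of proportion `≳ A^{-50}`. -/
theorem incomparable_subfamily :
    ∃ c > (0 : ℝ),
    ∀ A δ σ : ℝ, 100 ≤ A → 0 < δ → δ ≤ σ → σ ≤ 1 →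
    ∀ R : Finset (Param × Plane), (∀ r ∈ R, IsRectData r) →
      (∀ r ∈ R, ∀ r' ∈ R, r ≠ r' → ¬ Comp δ σ 100 r r') →
      ∃ R' ⊆ R, (∀ r ∈ R', ∀ r' ∈ R', r ≠ r' → ¬ Comp δ σ A r r') ∧
        c * A ^ (-(50 : ℝ)) * (R.card : ℝ) ≤ (R'.card : ℝ) := by
  classical
  refine ⟨1 / 1024, by norm_num, ?_⟩
  intro A δ σ hA hδ hδσ hσ1 R hR hinc
  have hσ : 0 < σ := by linarith
  have hA0 : 0 < A := by linarith
  obtain ⟨P, hP⟩ : ∃ P : Finset (Param × Plane) → Prop, ∀ S, P S ↔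
      ∀ r ∈ S, ∀ r' ∈ S, r ≠ r' → ¬ Comp δ σ A r r' := ⟨_, fun _ => Iff.rfl⟩
  obtain ⟨R', hR', hmax⟩ := Finset.exists_max_image (R.powerset.filter P) Finset.card
    ⟨∅, by simp [hP]⟩
  rw [Finset.mem_filter, Finset.mem_powerset, hP] at hR'
  obtain ⟨hsub, hind⟩ := hR'
  refine ⟨R', hsub, hind, ?_⟩
  have hcov : ∀ r ∈ R, ∃ r0 ∈ R', Comp δ σ A r r0 := by
    intro r hr
    by_cases hr' : r ∈ R'
    · exact ⟨r, hr', comp_refl (by linarith) hδ hσ (hR r hr)⟩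
    by_contra hno
    push Not at hno
    have := hmax (insert r R') (by
      rw [Finset.mem_filter, Finset.mem_powerset, hP]
      refine ⟨Finset.insert_subset hr hsub, ?_⟩
      intro a ha b hb hab
      rw [Finset.mem_insert] at ha hb
      rcases ha with rfl | ha
      · rcases hb with rfl | hb
        · exact absurd rfl hab
        · exact hno b hb
      · rcases hb with rfl | hb
        · exact fun h => hno a ha (comp_symm h)
        · exact hind a ha b hb hab)
    rw [Finset.card_insert_of_notMem hr'] at this
    omega
  have hcover : R ⊆ R'.biUnion (fun r0 => R.filter (fun r => Comp δ σ A r r0)) := by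
    intro r hr
    obtain ⟨r0, h0, hc⟩ := hcov r hr
    exact Finset.mem_biUnion.2 ⟨r0, h0, Finset.mem_filter.2 ⟨hr, hc⟩⟩
  have h1 : (R.card : ℝ) ≤ ∑ r0 ∈ R', ((R.filter (fun r => Comp δ σ A r r0)).card : ℝ) := by
    exact_mod_cast (Finset.card_le_card hcover).trans Finset.card_biUnion_le
  have h2 : ∑ r0 ∈ R', ((R.filter (fun r => Comp δ σ A r r0)).card : ℝ) ≤
      ∑ _r0 ∈ R', 1024 * A ^ 50 := by
    apply Finset.sum_le_sum
    intro r0 h0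
    apply nbr_card hA hδ hδσ hσ1 _ r0 (hR _ (hsub h0))
    · intro r hr; exact hR r (Finset.mem_filter.1 hr).1
    · intro r hr; exact (Finset.mem_filter.1 hr).2
    · intro r hr r' hr' hne
      exact hinc r (Finset.mem_filter.1 hr).1 r' (Finset.mem_filter.1 hr').1 hne
  rw [Finset.sum_const, nsmul_eq_mul] at h2
  have h3 := h1.trans h2
  have h4 : A ^ (-(50:ℝ)) = (A ^ 50)⁻¹ := by
    rw [Real.rpow_neg hA0.le]
    norm_cast
  rw [h4]
  have h5 : 0 < A ^ 50 := by positivity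
  calc 1 / 1024 * (A ^ 50)⁻¹ * (R.card : ℝ)
      ≤ 1 / 1024 * (A ^ 50)⁻¹ * ((R'.card : ℝ) * (1024 * A ^ 50)) := by gcongr
    _ = R'.card := by field_simp

end
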